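/- There exists a set X ⊆ ℕ that is loquaciously high for paths but not reticently high for paths. -/

import Mathlib

namespace CFT

open Nat.Partrec (Code)

/-- Relativized partial recursive functions: `f` is partial recursive in the
(total) oracle `O : ℕ → ℕ`.  This mirrors Mathlib's `Nat.Partrec`, with an
extra constructor for the oracle. -/
inductive RecursiveIn (O : ℕ → ℕ) : (ℕ →. ℕ) → Prop
  | zero : RecursiveIn O (pure 0)
  | succ : RecursiveIn O Nat.succ
  | left : RecursiveIn O ↑fun n : ℕ => n.unpair.1
  | right : RecursiveIn O ↑fun n : ℕ => n.unpair.2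
  | oracle : RecursiveIn O ↑O
  | pair {f g} : RecursiveIn O f → RecursiveIn O g →
      RecursiveIn O fun n => Nat.pair <$> f n <*> g n
  | comp {f g} : RecursiveIn O f → RecursiveIn O g →
      RecursiveIn O fun n => g n >>= f
  | prec {f g} : RecursiveIn O f → RecursiveIn O g →
      RecursiveIn O (Nat.unpaired fun a n =>
        n.rec (f a) fun y IH => do let i ← IH; g (Nat.pair a (Nat.pair y i)))
  | rfind {f} : RecursiveIn O f →
      RecursiveIn O fun a => Nat.rfind fun n => (fun m => m = 0) <$> f (Nat.pair a n)

/-- Partial functions between `Primcodable` types that are partial recursive in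
the oracle `O`. -/
def PartrecIn (O : ℕ → ℕ) {α σ : Type} [Primcodable α] [Primcodable σ] (f : α →. σ) : Prop :=
  RecursiveIn O fun n =>
    Part.bind (Part.ofOption (Encodable.decode (α := α) n)) fun a => (f a).map Encodable.encode

/-- Total functions between `Primcodable` types that are computable in the oracle `O`. -/
def ComputableIn (O : ℕ → ℕ) {α σ : Type} [Primcodable α] [Primcodable σ] (f : α → σ) : Prop :=
  PartrecIn O (f : α →. σ)

open Classical in
/-- The characteristic function of a set of naturals. -/
noncomputable def chi (A : Set ℕ) : ℕ → ℕ := fun n => if n ∈ A then 1 else 0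

/-- `A` is computably enumerable in (the characteristic function of) `X`. -/
def CEIn (X : Set ℕ) (A : Set ℕ) : Prop :=
  ∃ f : ℕ →. ℕ, PartrecIn (chi X) f ∧ ∀ n, n ∈ A ↔ (f n).Dom

/-- The `e`-th partial computable function `ℕ →. ℕ`. -/
def codeFn (e : ℕ) : ℕ →. ℕ := (Denumerable.ofNat Code e).eval

/-! ### Trees on ℕ -/

def PrefixClosed (T : Set (List ℕ)) : Prop := ∀ l ∈ T, ∀ l' : List ℕ, l' <+: l → l' ∈ T

/-- Index `e` decides a (prefix-closed) tree on `ℕ`. -/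
def DecidesTree (e : ℕ) : Prop :=
  (∀ n, (codeFn e n).Dom) ∧
    PrefixClosed {l : List ℕ | codeFn e (Encodable.encode l) = Part.some 1}

open Classical in
/-- The standard enumeration of computable trees on ℕ; indices that do not
decide a tree denote the empty tree. -/
noncomputable def treeAt (e : ℕ) : Set (List ℕ) :=
  if DecidesTree e then {l : List ℕ | codeFn e (Encodable.encode l) = Part.some 1} else ∅

/-- `f` is a path through the tree `T`: every finite initial segment
`[f 0, …, f (k-1)]` is in `T`. -/
def IsPath (T : Set (List ℕ)) (f : ℕ → ℕ) : Prop := ∀ k, (List.range k).map f ∈ T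

def IllFounded (T : Set (List ℕ)) : Prop := ∃ f, IsPath T f

/-- The set of indices of well-founded computable trees. -/
def WF : Set ℕ := {e | ¬ IllFounded (treeAt e)}

/-- `T` is a computable tree (prefix-closed and decided by a total computable function). -/
def ComputableTree (T : Set (List ℕ)) : Prop :=
  PrefixClosed T ∧ ∃ χ : List ℕ → Bool, Computable χ ∧ ∀ l, l ∈ T ↔ χ l = true

/-! ### Highness notions for paths -/

def HighForPaths (X : Set ℕ) : Prop :=
  ∀ T : Set (List ℕ), ComputableTree T → IllFounded T →
    ∃ f : ℕ → ℕ, ComputableIn (chi X) f ∧ IsPath T f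

def LoqHighForPaths (X : Set ℕ) : Prop :=
  ∃ F : ℕ × ℕ → ℕ, ComputableIn (chi X) F ∧
    ∀ e, IllFounded (treeAt e) → IsPath (treeAt e) fun n => F (e, n)

def UnifHighForPaths (X : Set ℕ) : Prop :=
  ∃ F : ℕ × ℕ →. ℕ, PartrecIn (chi X) F ∧
    ∀ e, IllFounded (treeAt e) →
      ∃ g : ℕ → ℕ, IsPath (treeAt e) g ∧ ∀ n, F (e, n) = Part.some (g n)

def RetHighForPaths (X : Set ℕ) : Prop :=
  ∃ F : ℕ × ℕ →. ℕ, PartrecIn (chi X) F ∧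
    (∀ e, IllFounded (treeAt e) →
      ∃ g : ℕ → ℕ, IsPath (treeAt e) g ∧ ∀ n, F (e, n) = Part.some (g n)) ∧
    (∀ e, ¬ IllFounded (treeAt e) → ∀ n, ¬ (F (e, n)).Dom)

/-! ### Σ¹₁ and Π¹₁ sets -/

def Sigma11 (A : Set ℕ) : Prop :=
  ∃ R : ℕ → List ℕ → Bool, Computable₂ R ∧
    ∀ n, n ∈ A ↔ ∃ f : ℕ → ℕ, ∀ k, R n ((List.range k).map f) = true

def Pi11 (A : Set ℕ) : Prop := Sigma11 Aᶜ

/-! ### Linear orders -/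

/-- A (presentation of a) linear order: a domain `D ⊆ ℕ` and a strict order
relation on it. -/
structure LinOrd where
  dom : Set ℕ
  lt : ℕ → ℕ → Prop

/-- `L` really is a strict linear order on its domain. -/
def LinOrd.IsValid (L : LinOrd) : Prop :=
  (∀ a b, L.lt a b → a ∈ L.dom ∧ b ∈ L.dom) ∧
  (∀ a, ¬ L.lt a a) ∧
  (∀ a b c, L.lt a b → L.lt b c → L.lt a c) ∧
  (∀ a ∈ L.dom, ∀ b ∈ L.dom, a = b ∨ L.lt a b ∨ L.lt b a)

def linOrdOfCodes (n : ℕ) : LinOrd :=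
  ⟨{a | codeFn n.unpair.1 a = Part.some 1},
   fun a b => codeFn n.unpair.2 (Nat.pair a b) = Part.some 1⟩

def DecidesLinOrd (n : ℕ) : Prop :=
  (∀ m, (codeFn n.unpair.1 m).Dom) ∧ (∀ m, (codeFn n.unpair.2 m).Dom) ∧
    (linOrdOfCodes n).IsValid

open Classical in
/-- The standard enumeration of computable linear orders; indices that do not
decide a linear order denote the empty order. -/
noncomputable def linOrdAt (n : ℕ) : LinOrd :=
  if DecidesLinOrd n then linOrdOfCodes n else ⟨∅, fun _ _ => False⟩

def IsDescSeq (L : LinOrd) (f : ℕ → ℕ) : Prop :=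
  ∀ i, f i ∈ L.dom ∧ L.lt (f (i + 1)) (f i)

def LinOrd.IllFounded (L : LinOrd) : Prop := ∃ f, IsDescSeq L f

/-- A tight descending sequence: a descending sequence that gets below every
descending sequence. -/
def IsTightDescSeq (L : LinOrd) (f : ℕ → ℕ) : Prop :=
  IsDescSeq L f ∧ ∀ g, IsDescSeq L g → ∀ n, ∃ m, L.lt (f m) (g n)

/-- `L` is a computable linear order. -/
def ComputableLinOrd (L : LinOrd) : Prop :=
  L.IsValid ∧
  (∃ χ : ℕ → Bool, Computable χ ∧ ∀ a, a ∈ L.dom ↔ χ a = true) ∧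
  (∃ χ : ℕ → ℕ → Bool, Computable₂ χ ∧ ∀ a b, L.lt a b ↔ χ a b = true)

def LoqHighForDS (X : Set ℕ) : Prop :=
  ∃ g : ℕ × ℕ → ℕ, ComputableIn (chi X) g ∧
    ∀ n, (linOrdAt n).IllFounded → IsDescSeq (linOrdAt n) fun k => g (n, k)

def HighForTightDS (X : Set ℕ) : Prop :=
  ∀ L : LinOrd, ComputableLinOrd L → L.IllFounded →
    ∃ f : ℕ → ℕ, ComputableIn (chi X) f ∧ IsTightDescSeq L f

def UnifHighForTightDS (X : Set ℕ) : Prop :=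
  ∃ F : ℕ × ℕ →. ℕ, PartrecIn (chi X) F ∧
    ∀ n, (linOrdAt n).IllFounded →
      ∃ g : ℕ → ℕ, IsTightDescSeq (linOrdAt n) g ∧ ∀ k, F (n, k) = Part.some (g k)

/-! ### Binary trees -/

def PrefixClosedB (B : Set (List Bool)) : Prop := ∀ l ∈ B, ∀ l' : List Bool, l' <+: l → l' ∈ B

def DecidesBTree (e : ℕ) : Prop :=
  (∀ n, (codeFn e n).Dom) ∧
    PrefixClosedB {l : List Bool | codeFn e (Encodable.encode l) = Part.some 1}

open Classical in
/-- The standard enumeration of computable binary trees; indices that do not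
decide a binary tree denote the full binary tree. -/
noncomputable def bTreeAt (e : ℕ) : Set (List Bool) :=
  if DecidesBTree e then {l : List Bool | codeFn e (Encodable.encode l) = Part.some 1}
  else Set.univ

def BInfinite (B : Set (List Bool)) : Prop := ∀ k, ∃ l ∈ B, l.length = k

def IsBPath (B : Set (List Bool)) (p : ℕ → Bool) : Prop := ∀ k, (List.range k).map p ∈ B



/-! ### Comparing nodes of computably enumerable trees -/

/-- The node obtained from `x` by appending the entry `j`. -/
def child (x : ℕ × List ℕ) (j : ℕ) : ℕ × List ℕ := (x.1, x.2 ++ [j])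

/-- The string `x.2` is accepted by the index `x.1`. -/
def InTree (x : ℕ × List ℕ) : Prop := codeFn x.1 (Encodable.encode x.2) = Part.some 1

/-- No path starts at the node `x`. -/
inductive Dead : ℕ × List ℕ → Prop
  | out {x} : ¬ InTree x → Dead x
  | step {x} : (∀ j, Dead (child x j)) → Dead x

/-- A relation between nodes that is preserved by passing to a suitable child. -/
def IsSimulation (R : ℕ × List ℕ → ℕ × List ℕ → Prop) : Prop :=
  ∀ x y, R x y → InTree x → InTree y ∧ ∀ j, ∃ i, R (child x j) (child y i)

/-- The largest simulation: a comparison of the ranks of nodes. -/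
def RankLE (x y : ℕ × List ℕ) : Prop := ∃ R, IsSimulation R ∧ R x y

theorem isSimulation_rankLE : IsSimulation RankLE := by
  rintro x y ⟨R, hR, hxy⟩ hx
  refine ⟨(hR x y hxy hx).1, fun j => ?_⟩
  obtain ⟨i, hi⟩ := (hR x y hxy hx).2 j
  exact ⟨i, R, hR, hi⟩

theorem rankLE_of_step {x y : ℕ × List ℕ}
    (h : InTree x → InTree y ∧ ∀ j, ∃ i, RankLE (child x j) (child y i)) : RankLE x y := by
  refine ⟨fun a b => RankLE a b ∨ (a = x ∧ b = y), ?_, Or.inr ⟨rfl, rfl⟩⟩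
  rintro a b (hab | ⟨rfl, rfl⟩) ha
  · refine ⟨(isSimulation_rankLE a b hab ha).1, fun j => ?_⟩
    obtain ⟨i, hi⟩ := (isSimulation_rankLE a b hab ha).2 j
    exact ⟨i, Or.inl hi⟩
  · refine ⟨(h ha).1, fun j => ?_⟩
    obtain ⟨i, hi⟩ := (h ha).2 j
    exact ⟨i, Or.inl hi⟩

theorem RankLE.trans {x y z : ℕ × List ℕ} (h₁ : RankLE x y) (h₂ : RankLE y z) : RankLE x z := by
  refine ⟨fun a c => ∃ b, RankLE a b ∧ RankLE b c, ?_, y, h₁, h₂⟩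
  rintro a c ⟨b, hab, hbc⟩ ha
  obtain ⟨hb, hab⟩ := isSimulation_rankLE a b hab ha
  obtain ⟨hc, hbc⟩ := isSimulation_rankLE b c hbc hb
  refine ⟨hc, fun j => ?_⟩
  obtain ⟨i, hi⟩ := hab j
  obtain ⟨k, hk⟩ := hbc i
  exact ⟨k, _, hi, hk⟩

theorem inTree_of_not_dead {x : ℕ × List ℕ} (h : ¬ Dead x) : InTree x := by
  by_contra hx
  exact h (.out hx)

theorem exists_child_not_dead {x : ℕ × List ℕ} (h : ¬ Dead x) : ∃ j, ¬ Dead (child x j) := by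
  by_contra! hx
  exact h (.step hx)

theorem RankLE.dead {x y : ℕ × List ℕ} (h : RankLE x y) (hy : Dead y) : Dead x := by
  induction hy generalizing x with
  | out hy => exact .out fun hx => hy (isSimulation_rankLE _ _ h hx).1
  | step _ ih =>
    by_cases hx : InTree x
    · refine .step fun j => ?_
      obtain ⟨i, hi⟩ := (isSimulation_rankLE _ _ h hx).2 j
      exact ih i hi
    · exact .out hx

theorem rankLE_of_not_dead (x : ℕ × List ℕ) {y : ℕ × List ℕ} (hy : ¬ Dead y) : RankLE x y := by
  refine ⟨fun _ b => ¬ Dead b, fun a b hb _ => ⟨inTree_of_not_dead hb, fun _ => ?_⟩, hy⟩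
  exact exists_child_not_dead hb

theorem rankLE_total (x y : ℕ × List ℕ) : RankLE x y ∨ RankLE y x := by
  by_cases hy : Dead y
  · induction hy generalizing x with
    | out hy => exact Or.inr (rankLE_of_step fun h => absurd h hy)
    | @step y _ ih =>
      by_cases hyT : InTree y
      · by_contra! hxy
        refine hxy.2 (rankLE_of_step fun _ => ?_)
        have hx : InTree x := by
          by_contra hx
          exact hxy.1 (rankLE_of_step fun h => absurd h hx)
        obtain ⟨j, hj⟩ : ∃ j, ∀ i, ¬ RankLE (child x j) (child y i) := by
          by_contra! h
          exact hxy.1 (rankLE_of_step fun _ => ⟨hyT, h⟩)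
        exact ⟨hx, fun i => ⟨j, (ih i _).resolve_left (hj i)⟩⟩
      · exact Or.inr (rankLE_of_step fun h => absurd h hyT)
  · exact Or.inl (rankLE_of_not_dead x hy)

/-- The node coded by a natural number. -/
def node (k : ℕ) : ℕ × List ℕ := Denumerable.ofNat (ℕ × List ℕ) k

/-- The `j`-th child of the node coded by `k` has maximal rank among the first `m + 1` children. -/
def BestChild (k m j : ℕ) : Prop := ∀ i ≤ m, RankLE (child (node k) i) (child (node k) j)

theorem exists_bestChild (k m : ℕ) : ∃ j ≤ m, BestChild k m j := by
  induction m with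
  | zero =>
    refine ⟨0, le_rfl, fun i hi => ?_⟩
    obtain rfl : i = 0 := by omega
    exact (or_self_iff.1 (rankLE_total _ _))
  | succ m ih =>
    obtain ⟨j, hjm, hj⟩ := ih
    rcases rankLE_total (child (node k) (m + 1)) (child (node k) j) with h | h
    · refine ⟨j, by omega, fun i hi => ?_⟩
      rcases Nat.le_succ_iff.1 hi with hi | rfl
      exacts [hj i hi, h]
    · refine ⟨m + 1, le_rfl, fun i hi => ?_⟩
      rcases Nat.le_succ_iff.1 hi with hi | rfl
      exacts [(hj i hi).trans h, or_self_iff.1 (rankLE_total _ _)]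

theorem BestChild.not_dead {k m j i : ℕ} (h : BestChild k m j) (hi : i ≤ m)
    (hd : ¬ Dead (child (node k) i)) : ¬ Dead (child (node k) j) :=
  fun hj => hd ((h i hi).dead hj)

theorem not_dead_root {e : ℕ} (h : IllFounded (treeAt e)) : ¬ Dead (e, []) := by
  obtain ⟨f, hf⟩ := h
  suffices H : ∀ x, Dead x → ∀ k, x = (e, (List.range k).map f) → False from
    fun hd => H _ hd 0 rfl
  intro x hx
  induction hx with
  | out hx =>
    rintro k rfl
    have hk := hf k
    rw [treeAt] at hk
    split_ifs at hk
    exacts [hx hk, hk]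
  | step _ ih =>
    rintro k rfl
    exact ih (f k) (k + 1) (by simp [child, List.range_succ])

theorem mem_treeAt_of_inTree {e : ℕ} (h : IllFounded (treeAt e)) {l : List ℕ}
    (hl : InTree (e, l)) : l ∈ treeAt e := by
  obtain ⟨f, hf⟩ := h
  have h₀ := hf 0
  rw [treeAt] at h₀ ⊢
  split_ifs at h₀ ⊢
  exacts [hl, h₀]

/-! ### Diagonalization against analytic definitions of ill-foundedness -/

theorem primrecPred_forall_mem {α β : Type} [Primcodable α] [Primcodable β] {p : α → β → Prop}
    {g : α → List β} (hp : PrimrecRel p) (hg : Primrec g) :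
    PrimrecPred fun a => ∀ b ∈ g a, p a b :=
  hp.swap.forall_mem_list.comp hg Primrec.id

theorem primrecPred_imp {α : Type} [Primcodable α] {p q : α → Prop}
    (hp : PrimrecPred p) (hq : PrimrecPred q) : PrimrecPred fun a => p a → q a :=
  (hp.not.or hq).of_eq fun _ => imp_iff_not_or.symm

theorem exists_iff_illFounded {R : ℕ → List ℕ → Prop} (hR : PrimrecRel R) :
    ∃ e, (∃ f : ℕ → ℕ, ∀ k, R e ((List.range k).map f)) ↔ IllFounded (treeAt e) := by
  classical
  let S : ℕ → List ℕ → Prop := fun e l => ∀ k ∈ List.range (l.length + 1), R e (l.take k)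
  have hS : PrimrecRel S := by
    refine primrecPred_forall_mem (α := ℕ × List ℕ)
      (p := fun a k => R a.1 (a.2.take k)) ?_ ?_
    · exact hR.comp (Primrec.fst.comp Primrec.fst)
        (Primrec.list_take.comp Primrec.snd (Primrec.snd.comp Primrec.fst))
    · exact Primrec.list_range.comp (Primrec.succ.comp (Primrec.list_length.comp Primrec.snd))
  have hg : Primrec₂ fun (c : Code) (n : ℕ) =>
      if S (Encodable.encode c) (Denumerable.ofNat (List ℕ) n) then 1 else 0 := by
    refine Primrec.ite ?_ (Primrec.const 1) (Primrec.const 0)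
    exact hS.comp (Primrec.encode.comp Primrec.fst) ((Primrec.ofNat _).comp Primrec.snd)
  obtain ⟨c, hc⟩ := Code.fixed_point₂ (Primrec₂.to_comp hg).partrec₂
  refine ⟨Encodable.encode c, ?_⟩
  have hcode : ∀ n, codeFn (Encodable.encode c) n = Part.some
      (if S (Encodable.encode c) (Denumerable.ofNat (List ℕ) n) then 1 else 0) := fun n => by
    rw [codeFn, Denumerable.ofNat_encode, hc]
    rfl
  have hmem : ∀ l : List ℕ, codeFn (Encodable.encode c) (Encodable.encode l) = Part.some 1 ↔
      S (Encodable.encode c) l := fun l => by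
    rw [hcode, Denumerable.ofNat_encode, Part.some_inj]
    split_ifs with h <;> simp [h]
  have hdec : DecidesTree (Encodable.encode c) := by
    refine ⟨fun n => by rw [hcode]; trivial, fun l hl l' hl' => ?_⟩
    rw [Set.mem_ofPred_eq, hmem] at hl ⊢
    intro k hk
    have hk' : k ≤ l'.length := by simpa [Nat.lt_succ_iff] using hk
    obtain ⟨t, rfl⟩ := hl'
    have := hl k (by simp; omega)
    rwa [List.take_append_of_le_length hk'] at this
  have htree : ∀ l, l ∈ treeAt (Encodable.encode c) ↔ S (Encodable.encode c) l := fun l => by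
    rw [treeAt, if_pos hdec, Set.mem_ofPred_eq, hmem]
  refine exists_congr fun f => ⟨fun h k => (htree _).2 fun i hi => ?_, fun h k => ?_⟩
  · have hi' : i ≤ k := by simpa [Nat.lt_succ_iff] using hi
    rw [← List.map_take, List.take_range, min_eq_left hi']
    exact h i
  · have := (htree _).1 (h k) k (by simp)
    rwa [List.take_of_length_le (by simp)] at this

/-- A `Σ¹₁` formula in Skolem normal form is equivalent to ill-foundedness at some index. -/
theorem exists_iff_illFounded_of_bound {β : Type} [Primcodable β] {C : ℕ → β → (ℕ → ℕ) → Prop}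
    {B : ℕ → β → List ℕ → Prop} {bound : β → ℕ} (hbound : Primrec bound)
    (hB : PrimrecPred fun a : ℕ × β × List ℕ => B a.1 a.2.1 a.2.2)
    (hBC : ∀ e b f k, bound b ≤ k → (B e b ((List.range k).map f) ↔ C e b f)) :
    ∃ e, (∃ f : ℕ → ℕ, ∀ b, C e b f) ↔ IllFounded (treeAt e) := by
  let R : ℕ → List ℕ → Prop := fun e l =>
    ∀ n ∈ List.range l.length, ∀ b ∈ (Encodable.decode (α := β) n).toList,
      bound b ≤ l.length → B e b l
  have hR : PrimrecRel R := by
    refine primrecPred_forall_mem (α := ℕ × List ℕ) ?_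
      (Primrec.list_range.comp (Primrec.list_length.comp Primrec.snd))
    refine primrecPred_forall_mem (α := (ℕ × List ℕ) × ℕ)
      (p := fun a b => bound b ≤ a.1.2.length → B a.1.1 b a.1.2)
      (g := fun a => (Encodable.decode (α := β) a.2).toList) ?_ ?_
    · refine primrecPred_imp ?_ ?_
      · exact Primrec.nat_le.comp (hbound.comp Primrec.snd)
          (Primrec.list_length.comp (Primrec.snd.comp (Primrec.fst.comp Primrec.fst)))
      · exact hB.comp ((Primrec.fst.comp (Primrec.fst.comp Primrec.fst)).pair
          (Primrec.snd.pair (Primrec.snd.comp (Primrec.fst.comp Primrec.fst))))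
    · have : Primrec fun o : Option β => o.toList := by
        refine (Primrec.option_casesOn Primrec.id (Primrec.const ([] : List β))
          (Primrec.list_cons.comp Primrec.snd (Primrec.const [])).to₂).of_eq fun o => ?_
        cases o <;> rfl
      exact this.comp (Primrec.decode.comp Primrec.snd)
  obtain ⟨e, he⟩ := exists_iff_illFounded hR
  refine ⟨e, Iff.trans (exists_congr fun f => ⟨fun h k => ?_, fun h b => ?_⟩) he⟩
  · intro n _ b _ hk
    rw [List.length_map, List.length_range] at hk
    exact (hBC e b f k hk).2 (h b)
  · have := h (max (bound b) (Encodable.encode b + 1)) (Encodable.encode b)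
      (by simp) b (by simp) (by simp)
    exact (hBC e b f _ (le_max_left _ _)).1 this

/-! ### Strings all of whose admissible extensions run into a given set -/

/-- The least set of strings containing `θ` and every string `τ` for which there are arbitrarily
large bounds `m` such that all the best choices of a child below `m` at the node coded by
`τ.length` lead into the set. -/
inductive Good (θ : List ℕ → Prop) : List ℕ → Prop
  | base {τ} : θ τ → Good θ τ
  | step {τ} (g : ℕ → ℕ) : (∀ m, m ≤ g m) →
      (∀ m j, BestChild τ.length (g m) j → Good θ (τ ++ [Nat.pair (g m) j])) → Good θ τ

theorem exists_not_good_step {θ : List ℕ → Prop} {τ : List ℕ} (h : ¬ Good θ τ) :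
    ∃ m, ∀ m' ≥ m, ∃ j, BestChild τ.length m' j ∧ ¬ Good θ (τ ++ [Nat.pair m' j]) := by
  by_contra! H
  choose g hg hgood using H
  exact h (.step g hg hgood)

theorem inTree_iff_evaln {x : ℕ × List ℕ} :
    InTree x ↔ ∃ s, Code.evaln s (Denumerable.ofNat Code x.1) (Encodable.encode x.2) = some 1 := by
  rw [InTree, codeFn, Part.eq_some_iff, Code.evaln_complete]
  rfl

/-- The position of the entry for `b` in the `n`-th component of a sequence of naturals. -/
def slot {β : Type} [Encodable β] (n : ℕ) (b : β) : ℕ := Nat.pair n (Encodable.encode b)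

theorem primrec_slot {α β : Type} [Primcodable α] [Primcodable β] (n : ℕ) {g : α → β}
    (hg : Primrec g) : Primrec fun a => slot n (g a) :=
  Primrec₂.natPair.comp (Primrec.const n) (Primrec.encode.comp hg)

theorem exists_slot_eq {α β γ δ : Type} [Denumerable α] [Denumerable β] [Denumerable γ]
    [Denumerable δ] (F₀ : α → ℕ) (F₁ : β → ℕ) (F₂ : γ → ℕ) (F₃ : δ → ℕ) :
    ∃ f : ℕ → ℕ, (∀ a, f (slot 0 a) = F₀ a) ∧ (∀ b, f (slot 1 b) = F₁ b) ∧
      (∀ c, f (slot 2 c) = F₂ c) ∧ ∀ d, f (slot 3 d) = F₃ d := by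
  refine ⟨fun q => match q.unpair.1 with
    | 0 => F₀ (Denumerable.ofNat _ q.unpair.2)
    | 1 => F₁ (Denumerable.ofNat _ q.unpair.2)
    | 2 => F₂ (Denumerable.ofNat _ q.unpair.2)
    | _ => F₃ (Denumerable.ofNat _ q.unpair.2), ?_⟩
  simp [slot]

/-- The closure condition on a set of strings that avoids `θ`; the set is coded in the
component `0` of `f`, a Skolem function in component `1`, and a simulation in component `2`. -/
def AvoidsAt (θ : List ℕ → Prop) (b : List ℕ × ℕ × ℕ × ℕ) (f : ℕ → ℕ) : Prop :=
  f (slot 0 b.1) ≠ 0 → ¬ θ b.1 ∧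
    (f (slot 0 b.1) ≤ b.2.1 → f (slot 1 (b.1, b.2.1)) = b.2.2.2 →
      f (slot 0 (b.1 ++ [Nat.pair b.2.1 b.2.2.2])) ≠ 0 ∧
      (b.2.2.1 ≤ b.2.1 → f (slot 2 (child (node b.1.length) b.2.2.1,
        child (node b.1.length) b.2.2.2)) ≠ 0))

/-- The closure condition on a simulation coded in the component `2` of `f`, with a Skolem
function coded in component `3`. -/
def SimulatesAt (b : (ℕ × List ℕ) × (ℕ × List ℕ) × ℕ × ℕ × ℕ) (f : ℕ → ℕ) : Prop :=
  f (slot 2 (b.1, b.2.1)) ≠ 0 →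
    Code.evaln b.2.2.2.1 (Denumerable.ofNat Code b.1.1) (Encodable.encode b.1.2) = some 1 →
    Code.evaln (f (slot 2 (b.1, b.2.1))) (Denumerable.ofNat Code b.2.1.1)
        (Encodable.encode b.2.1.2) = some 1 ∧
      (f (slot 3 (b.1, b.2.1, b.2.2.1)) = b.2.2.2.2 →
        f (slot 2 (child b.1 b.2.2.1, child b.2.1 b.2.2.2.2)) ≠ 0)

theorem not_good_iff_exists (θ : List ℕ → Prop) (σ : List ℕ) :
    ¬ Good θ σ ↔ ∃ f : ℕ → ℕ, f (slot 0 σ) ≠ 0 ∧ (∀ b, AvoidsAt θ b f) ∧ ∀ b, SimulatesAt b f := by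
  classical
  constructor
  · intro hσ
    have hM : ∀ τ, ∃ M, ¬ Good θ τ → ∀ m ≥ M, ∃ j,
        BestChild τ.length m j ∧ ¬ Good θ (τ ++ [Nat.pair m j]) := fun τ => by
      by_cases h : Good θ τ
      · exact ⟨0, fun h' => absurd h h'⟩
      · obtain ⟨M, hM⟩ := exists_not_good_step h
        exact ⟨M, fun _ => hM⟩
    choose M hM using hM
    have hJ : ∀ b : List ℕ × ℕ, ∃ j, ¬ Good θ b.1 → M b.1 ≤ b.2 →
        BestChild b.1.length b.2 j ∧ ¬ Good θ (b.1 ++ [Nat.pair b.2 j]) := fun b => by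
      by_cases h : ¬ Good θ b.1 ∧ M b.1 ≤ b.2
      · obtain ⟨j, hj⟩ := hM b.1 h.1 b.2 h.2
        exact ⟨j, fun _ _ => hj⟩
      · exact ⟨0, fun h₁ h₂ => absurd ⟨h₁, h₂⟩ h⟩
    choose J hJ using hJ
    have hS : ∀ y : ℕ × List ℕ, ∃ s, s ≠ 0 ∧ (InTree y →
        Code.evaln s (Denumerable.ofNat Code y.1) (Encodable.encode y.2) = some 1) := fun y => by
      by_cases h : InTree y
      · obtain ⟨s, hs⟩ := inTree_iff_evaln.1 h
        refine ⟨s + 1, s.succ_ne_zero, fun _ => ?_⟩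
        exact Code.evaln_mono s.le_succ hs
      · exact ⟨1, one_ne_zero, fun h' => absurd h' h⟩
    choose S hS₀ hS using hS
    have hI : ∀ d : (ℕ × List ℕ) × (ℕ × List ℕ) × ℕ, ∃ i, RankLE d.1 d.2.1 → InTree d.1 →
        RankLE (child d.1 d.2.2) (child d.2.1 i) := fun d => by
      by_cases h : RankLE d.1 d.2.1 ∧ InTree d.1
      · obtain ⟨i, hi⟩ := (isSimulation_rankLE _ _ h.1 h.2).2 d.2.2
        exact ⟨i, fun _ _ => hi⟩
      · exact ⟨0, fun h₁ h₂ => absurd ⟨h₁, h₂⟩ h⟩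
    choose I hI using hI
    obtain ⟨f, h₀, h₁, h₂, h₃⟩ := exists_slot_eq (fun τ => if Good θ τ then 0 else M τ + 1) J
      (fun c : (ℕ × List ℕ) × (ℕ × List ℕ) => if RankLE c.1 c.2 then S c.2 else 0) I
    have hf₀ : ∀ τ, f (slot 0 τ) ≠ 0 ↔ ¬ Good θ τ := fun τ => by simp [h₀]
    have hf₂ : ∀ x y, f (slot 2 (x, y)) ≠ 0 ↔ RankLE x y := fun x y => by simp [h₂, hS₀]
    refine ⟨f, (hf₀ σ).2 hσ, ?_, ?_⟩
    · rintro ⟨τ, m, i, j⟩ hτ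
      rw [hf₀] at hτ
      refine ⟨fun h => hτ (.base h), fun hm hj => ?_⟩
      simp only [h₀, h₁, if_neg hτ] at hm hj
      subst hj
      obtain ⟨hbest, hng⟩ := hJ (τ, m) hτ (by simp only; omega)
      exact ⟨(hf₀ _).2 hng, fun hi => (hf₂ _ _).2 (hbest i hi)⟩
    · rintro ⟨x, y, j, s, i⟩ hxy hx
      rw [hf₂] at hxy
      have hxT : InTree x := inTree_iff_evaln.2 ⟨s, hx⟩
      refine ⟨?_, fun hi => ?_⟩
      · simp only [h₂, if_pos hxy]
        exact hS y (isSimulation_rankLE x y hxy hxT).1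
      · simp only [h₃] at hi
        subst hi
        exact (hf₂ _ _).2 (hI (x, y, j) hxy hxT)
  · rintro ⟨f, hσ, hU, hR⟩
    have hsim : IsSimulation fun x y => f (slot 2 (x, y)) ≠ 0 := by
      intro x y hxy hx
      obtain ⟨s, hs⟩ := inTree_iff_evaln.1 hx
      exact ⟨inTree_iff_evaln.2 ⟨_, (hR (x, y, 0, s, 0) hxy hs).1⟩,
        fun j => ⟨f (slot 3 (x, y, j)), (hR (x, y, j, s, f (slot 3 (x, y, j))) hxy hs).2 rfl⟩⟩
    intro hgood
    induction hgood with
    | @base τ h => exact (hU (τ, 0, 0, 0) hσ).1 h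
    | @step τ g hg _ ih =>
      refine ih (f (slot 0 τ)) (f (slot 1 (τ, g (f (slot 0 τ))))) (fun i hi => ?_) ?_
      · exact ⟨_, hsim, (((hU (τ, _, i, _) hσ).2 (hg _)) rfl).2 hi⟩
      · exact (((hU (τ, _, 0, _) hσ).2 (hg _)) rfl).1

theorem primrec_child {α : Type} [Primcodable α] {x : α → ℕ × List ℕ} {j : α → ℕ}
    (hx : Primrec x) (hj : Primrec j) : Primrec fun a => child (x a) (j a) :=
  (Primrec.fst.comp hx).pair (Primrec.list_concat.comp (Primrec.snd.comp hx) hj)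

theorem primrecPred_evaln_eq {α : Type} [Primcodable α] {s : α → ℕ} {x : α → ℕ × List ℕ}
    (hs : Primrec s) (hx : Primrec x) : PrimrecPred fun a =>
      Code.evaln (s a) (Denumerable.ofNat Code (x a).1) (Encodable.encode (x a).2) = some 1 :=
  Primrec.eq.comp (Code.primrec_evaln.comp ((hs.pair ((Primrec.ofNat Code).comp
    (Primrec.fst.comp hx))).pair (Primrec.encode.comp (Primrec.snd.comp hx)))) (Primrec.const _)

theorem primrecPred_avoidsAt {θ : ℕ → List ℕ → Prop} (hθ : PrimrecRel θ) :
    PrimrecPred fun a : ℕ × (List ℕ × ℕ × ℕ × ℕ) × List ℕ =>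
      AvoidsAt (θ a.1) a.2.1 fun q => a.2.2.getD q 0 := by
  have hb : Primrec fun a : ℕ × (List ℕ × ℕ × ℕ × ℕ) × List ℕ => a.2.1 :=
    Primrec.fst.comp Primrec.snd
  have hτ := Primrec.fst.comp hb
  have hm := Primrec.fst.comp (Primrec.snd.comp hb)
  have hi := Primrec.fst.comp (Primrec.snd.comp (Primrec.snd.comp hb))
  have hj := Primrec.snd.comp (Primrec.snd.comp (Primrec.snd.comp hb))
  have hl : Primrec fun a : ℕ × (List ℕ × ℕ × ℕ × ℕ) × List ℕ => a.2.2 :=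
    Primrec.snd.comp Primrec.snd
  have hx : Primrec fun a : ℕ × (List ℕ × ℕ × ℕ × ℕ) × List ℕ => node a.2.1.1.length :=
    (Primrec.ofNat _).comp (Primrec.list_length.comp hτ)
  have get {q : ℕ × (List ℕ × ℕ × ℕ × ℕ) × List ℕ → ℕ} (hq : Primrec q) :
      Primrec fun a : ℕ × (List ℕ × ℕ × ℕ × ℕ) × List ℕ => a.2.2.getD (q a) 0 :=
    (Primrec.list_getD 0).comp hl hq
  have h₀ := get (primrec_slot 0 hτ)
  refine primrecPred_imp (Primrec.eq.comp h₀ (Primrec.const 0)).not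
    ((hθ.comp Primrec.fst hτ).not.and (primrecPred_imp (Primrec.nat_le.comp h₀ hm)
      (primrecPred_imp (Primrec.eq.comp (get (primrec_slot 1 (hτ.pair hm))) hj) (.and ?_ ?_))))
  · exact (Primrec.eq.comp (get (primrec_slot 0 (Primrec.list_concat.comp hτ
      (Primrec₂.natPair.comp hm hj)))) (Primrec.const 0)).not
  · exact primrecPred_imp (Primrec.nat_le.comp hi hm) (Primrec.eq.comp (get (primrec_slot 2
      ((primrec_child hx hi).pair (primrec_child hx hj)))) (Primrec.const 0)).not

theorem primrecPred_simulatesAt :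
    PrimrecPred fun a : ((ℕ × List ℕ) × (ℕ × List ℕ) × ℕ × ℕ × ℕ) × List ℕ =>
      SimulatesAt a.1 fun q => a.2.getD q 0 := by
  have hx := Primrec.fst.comp (Primrec.fst (α := (ℕ × List ℕ) × (ℕ × List ℕ) × ℕ × ℕ × ℕ)
    (β := List ℕ))
  have hb := Primrec.snd.comp (Primrec.fst (α := (ℕ × List ℕ) × (ℕ × List ℕ) × ℕ × ℕ × ℕ)
    (β := List ℕ))
  have hy := Primrec.fst.comp hb
  have hj := Primrec.fst.comp (Primrec.snd.comp hb)
  have hs := Primrec.fst.comp (Primrec.snd.comp (Primrec.snd.comp hb))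
  have hi := Primrec.snd.comp (Primrec.snd.comp (Primrec.snd.comp hb))
  have get {q : ((ℕ × List ℕ) × (ℕ × List ℕ) × ℕ × ℕ × ℕ) × List ℕ → ℕ} (hq : Primrec q) :
      Primrec fun a : ((ℕ × List ℕ) × (ℕ × List ℕ) × ℕ × ℕ × ℕ) × List ℕ => a.2.getD (q a) 0 :=
    (Primrec.list_getD 0).comp Primrec.snd hq
  have h₂ := get (primrec_slot 2 (hx.pair hy))
  refine primrecPred_imp (Primrec.eq.comp h₂ (Primrec.const 0)).not
    (primrecPred_imp (primrecPred_evaln_eq hs hx) ((primrecPred_evaln_eq h₂ hy).and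
      (primrecPred_imp (Primrec.eq.comp (get (primrec_slot 3 (hx.pair (hy.pair hj)))) hi) ?_)))
  exact (Primrec.eq.comp (get (primrec_slot 2
    ((primrec_child hx hj).pair (primrec_child hy hi)))) (Primrec.const 0)).not

/-- An upper bound for the positions inspected by `AvoidsAt`. -/
def avoidsBound (b : List ℕ × ℕ × ℕ × ℕ) : ℕ :=
  slot 0 b.1 + slot 1 (b.1, b.2.1) + slot 0 (b.1 ++ [Nat.pair b.2.1 b.2.2.2]) +
    slot 2 (child (node b.1.length) b.2.2.1, child (node b.1.length) b.2.2.2) + 1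

/-- An upper bound for the positions inspected by `SimulatesAt`. -/
def simulatesBound (b : (ℕ × List ℕ) × (ℕ × List ℕ) × ℕ × ℕ × ℕ) : ℕ :=
  slot 2 (b.1, b.2.1) + slot 3 (b.1, b.2.1, b.2.2.1) +
    slot 2 (child b.1 b.2.2.1, child b.2.1 b.2.2.2.2) + 1

theorem primrec_avoidsBound : Primrec avoidsBound := by
  have hτ := Primrec.fst (α := List ℕ) (β := ℕ × ℕ × ℕ)
  have hm := Primrec.fst.comp (Primrec.snd (α := List ℕ) (β := ℕ × ℕ × ℕ))
  have hi := Primrec.fst.comp (Primrec.snd.comp (Primrec.snd (α := List ℕ) (β := ℕ × ℕ × ℕ)))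
  have hj := Primrec.snd.comp (Primrec.snd.comp (Primrec.snd (α := List ℕ) (β := ℕ × ℕ × ℕ)))
  have hx : Primrec fun b : List ℕ × ℕ × ℕ × ℕ => node b.1.length :=
    (Primrec.ofNat _).comp (Primrec.list_length.comp hτ)
  exact Primrec.succ.comp (Primrec.nat_add.comp (Primrec.nat_add.comp (Primrec.nat_add.comp
    (primrec_slot 0 hτ) (primrec_slot 1 (hτ.pair hm)))
    (primrec_slot 0 (Primrec.list_concat.comp hτ (Primrec₂.natPair.comp hm hj))))
    (primrec_slot 2 ((primrec_child hx hi).pair (primrec_child hx hj))))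

theorem primrec_simulatesBound : Primrec simulatesBound := by
  have hx := Primrec.fst (α := ℕ × List ℕ) (β := (ℕ × List ℕ) × ℕ × ℕ × ℕ)
  have hb := Primrec.snd (α := ℕ × List ℕ) (β := (ℕ × List ℕ) × ℕ × ℕ × ℕ)
  have hy := Primrec.fst.comp hb
  have hj := Primrec.fst.comp (Primrec.snd.comp hb)
  have hi := Primrec.snd.comp (Primrec.snd.comp (Primrec.snd.comp hb))
  exact Primrec.succ.comp (Primrec.nat_add.comp (Primrec.nat_add.comp
    (primrec_slot 2 (hx.pair hy)) (primrec_slot 3 (hx.pair (hy.pair hj))))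
    (primrec_slot 2 ((primrec_child hx hj).pair (primrec_child hy hi))))

theorem getD_map_range (f : ℕ → ℕ) {q k : ℕ} (h : q < k) :
    ((List.range k).map f).getD q 0 = f q := by
  simp [List.getD_eq_getElem?_getD, h]

theorem exists_not_good_iff_illFounded {θ : ℕ → List ℕ → Prop} (hθ : PrimrecRel θ) (σ : List ℕ) :
    ∃ e, ¬ Good (θ e) σ ↔ IllFounded (treeAt e) := by
  refine (exists_iff_illFounded_of_bound
    (β := (List ℕ × ℕ × ℕ × ℕ) × ((ℕ × List ℕ) × (ℕ × List ℕ) × ℕ × ℕ × ℕ))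
    (C := fun e b f => f (slot 0 σ) ≠ 0 ∧ AvoidsAt (θ e) b.1 f ∧ SimulatesAt b.2 f)
    (B := fun e b l => l.getD (slot 0 σ) 0 ≠ 0 ∧ AvoidsAt (θ e) b.1 (fun q => l.getD q 0) ∧
      SimulatesAt b.2 fun q => l.getD q 0)
    (bound := fun b => slot 0 σ + avoidsBound b.1 + simulatesBound b.2)
    (Primrec.nat_add.comp (Primrec.nat_add.comp (Primrec.const _)
      (primrec_avoidsBound.comp Primrec.fst)) (primrec_simulatesBound.comp Primrec.snd))
    ?_ ?_).imp fun e he => ?_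
  · refine .and ?_ (.and ?_ ?_)
    · exact (Primrec.eq.comp ((Primrec.list_getD 0).comp (Primrec.snd.comp Primrec.snd)
        (Primrec.const _)) (Primrec.const 0)).not
    · exact (primrecPred_avoidsAt hθ).comp (Primrec.fst.pair
        ((Primrec.fst.comp (Primrec.fst.comp Primrec.snd)).pair (Primrec.snd.comp Primrec.snd)))
    · exact primrecPred_simulatesAt.comp ((Primrec.snd.comp (Primrec.fst.comp Primrec.snd)).pair
        (Primrec.snd.comp Primrec.snd))
  · rintro e ⟨⟨τ, m, i, j⟩, ⟨x, y, j', s, i'⟩⟩ f k hk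
    simp only [avoidsBound, simulatesBound] at hk
    simp only [AvoidsAt, SimulatesAt]
    simp only [getD_map_range f (q := slot 0 σ) (k := k) (by omega),
      getD_map_range f (q := slot 0 τ) (k := k) (by omega),
      getD_map_range f (q := slot 1 (τ, m)) (k := k) (by omega),
      getD_map_range f (q := slot 0 (τ ++ [Nat.pair m j])) (k := k) (by omega),
      getD_map_range f (q := slot 2 (child (node τ.length) i, child (node τ.length) j)) (k := k)
        (by omega),
      getD_map_range f (q := slot 2 (x, y)) (k := k) (by omega),
      getD_map_range f (q := slot 3 (x, y, j')) (k := k) (by omega),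
      getD_map_range f (q := slot 2 (child x j', child y i')) (k := k) (by omega)]
  · exact ((not_good_iff_exists _ _).trans (Iff.trans (exists_congr fun f =>
      ⟨fun h b => ⟨h.1, h.2.1 b.1, h.2.2 b.2⟩,
      fun h => ⟨(h (([], 0, 0, 0), ((0, []), (0, []), 0, 0, 0))).1,
        fun b => (h (b, ((0, []), (0, []), 0, 0, 0))).2.1,
        fun b => (h (([], 0, 0, 0), b)).2.2⟩⟩) he))

/-! ### Forcing with strings that are not good -/

/-- The value `v` selects at the node coded by `k` a child that starts a path, if there is one. -/
def Adequate (k v : ℕ) : Prop :=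
  (∃ i, ¬ Dead (child (node k) i)) → ¬ Dead (child (node k) v.unpair.2)

/-- The string `τ` arises from `σ` by appending adequate values. -/
def Extends : List ℕ → List ℕ → Prop :=
  Relation.ReflTransGen fun σ τ => ∃ v, Adequate σ.length v ∧ τ = σ ++ [v]

theorem Extends.isPrefix {σ τ : List ℕ} (h : Extends σ τ) : σ <+: τ := by
  induction h with
  | refl => exact List.prefix_rfl
  | tail _ h ih =>
    obtain ⟨v, -, rfl⟩ := h
    exact ih.trans (List.prefix_append _ _)

theorem Extends.adequate {σ : List ℕ} (h : Extends [] σ) {k v : ℕ} (hv : σ[k]? = some v) :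
    Adequate k v := by
  induction h with
  | refl => simp at hv
  | @tail σ _ _ h ih =>
    obtain ⟨w, hw, rfl⟩ := h
    rcases lt_trichotomy k σ.length with hk | rfl | hk
    · exact ih (by rwa [List.getElem?_append_left hk] at hv)
    · rw [List.getElem?_concat_length, Option.some_inj] at hv
      exact hv ▸ hw
    · rw [List.getElem?_eq_none (by simp; omega)] at hv
      simp at hv

theorem exists_adequate_of_bestChild (k : ℕ) :
    ∃ n, ∀ m ≥ n, ∀ j, BestChild k m j → Adequate k (Nat.pair m j) := by
  by_cases h : ∃ i, ¬ Dead (child (node k) i)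
  · obtain ⟨i, hi⟩ := h
    refine ⟨i, fun m hm j hj _ => ?_⟩
    rw [Nat.unpair_pair]
    exact hj.not_dead hm hi
  · exact ⟨0, fun _ _ _ _ h' => absurd h' h⟩

theorem exists_adequate_not_good {θ : List ℕ → Prop} {τ : List ℕ} (h : ¬ Good θ τ) :
    ∃ v, Adequate τ.length v ∧ ¬ Good θ (τ ++ [v]) := by
  obtain ⟨m, hm⟩ := exists_not_good_step h
  obtain ⟨n, hn⟩ := exists_adequate_of_bestChild τ.length
  obtain ⟨j, hj, hgood⟩ := hm (max m n) (le_max_left _ _)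
  exact ⟨_, hn _ (le_max_right _ _) j hj, hgood⟩

theorem not_good_false (τ : List ℕ) : ¬ Good (fun _ => False) τ := by
  intro h
  induction h with
  | base h => exact h
  | @step τ g _ _ ih =>
    obtain ⟨j, -, hj⟩ := exists_bestChild τ.length (g 0)
    exact ih 0 j hj

theorem Good.or_exists_extends {θ φ : List ℕ → Prop} {σ : List ℕ}
    (h : Good (fun τ => θ τ ∨ φ τ) σ) : Good θ σ ∨ ∃ τ, Extends σ τ ∧ φ τ ∧ ¬ Good θ τ := by
  induction h with
  | @base σ h =>
    by_cases hσ : Good θ σ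
    · exact Or.inl hσ
    · exact Or.inr ⟨σ, .refl, h.resolve_left fun h => hσ (.base h), hσ⟩
  | @step σ g hg _ ih =>
    by_cases hσ : Good θ σ
    · exact Or.inl hσ
    · obtain ⟨m, hm⟩ := exists_not_good_step hσ
      obtain ⟨n, hn⟩ := exists_adequate_of_bestChild σ.length
      have hmn := hg (max m n)
      obtain ⟨j, hj, hgood⟩ := hm _ ((le_max_left _ _).trans hmn)
      obtain ⟨τ, hτ, h⟩ := (ih _ j hj).resolve_left hgood
      exact Or.inr ⟨τ, .head ⟨_, hn _ ((le_max_right _ _).trans hmn) j hj, rfl⟩ hτ, h⟩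

/-- A relation that persists to extensions in the first argument. -/
def Persistent (φ : List ℕ → ℕ → Prop) : Prop := ∀ ⦃σ τ e⦄, σ <+: τ → φ σ e → φ τ e

theorem exists_extends_decides {θ : List ℕ → Prop} (hθ : PrimrecPred θ) {σ : List ℕ}
    (hσ : ¬ Good θ σ) {φ : List ℕ → ℕ → Prop} (hφ : PrimrecRel φ) (hmono : Persistent φ) :
    ∃ θ' σ', PrimrecPred θ' ∧ ¬ Good θ' σ' ∧ Extends σ σ' ∧ σ.length < σ'.length ∧
      (∀ τ, θ τ → θ' τ) ∧ ∃ e, (¬ IllFounded (treeAt e) ∧ φ σ' e) ∨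
        (IllFounded (treeAt e) ∧ ∀ τ, φ τ e → θ' τ) := by
  have key : PrimrecRel fun e τ => θ τ ∨ φ τ e := (hθ.comp Primrec.snd).or hφ.swap
  obtain ⟨e, he⟩ := exists_not_good_iff_illFounded key σ
  by_cases hgood : Good (fun τ => θ τ ∨ φ τ e) σ
  · obtain ⟨τ, hστ, hτ, hgood'⟩ := hgood.or_exists_extends.resolve_left hσ
    obtain ⟨v, hv, hτv⟩ := exists_adequate_not_good hgood'
    refine ⟨θ, τ ++ [v], hθ, hτv, hστ.tail ⟨v, hv, rfl⟩, ?_, fun _ => id, e, .inl ⟨?_, ?_⟩⟩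
    · have := hστ.isPrefix.length_le
      simp only [List.length_append, List.length_singleton]
      omega
    · exact fun h => he.2 h hgood
    · exact hmono (List.prefix_append _ _) hτ
  · obtain ⟨v, hv, hσv⟩ := exists_adequate_not_good hgood
    exact ⟨_, σ ++ [v], key.comp (Primrec.const e) Primrec.id, hσv, .single ⟨v, hv, rfl⟩,
      by simp, fun _ => Or.inl, e, .inr ⟨he.1 hgood, fun _ => Or.inr⟩⟩

theorem primrecPred_false {α : Type} [Primcodable α] : PrimrecPred fun _ : α => False :=
  ⟨inferInstance, (Primrec.const false).of_eq fun _ => rfl⟩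

theorem map_range_isPrefix (f : ℕ → ℕ) {k n : ℕ} (h : k ≤ n) :
    (List.range k).map f <+: (List.range n).map f := by
  refine List.IsPrefix.map f ?_
  rw [← min_eq_left h, ← List.take_range]
  exact ⟨_, List.take_append_drop k _⟩

theorem exists_adequate_of_seq (Φ : ℕ → List ℕ → ℕ → Prop) (hΦ : ∀ i, PrimrecRel (Φ i))
    (hmono : ∀ i, Persistent (Φ i)) : ∃ O : ℕ → ℕ, (∀ k, Adequate k (O k)) ∧
      ∀ i, ¬ ∀ e, (∃ k, Φ i ((List.range k).map O) e) ↔ IllFounded (treeAt e) := by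
  let State := {s : (List ℕ → Prop) × List ℕ // PrimrecPred s.1 ∧ ¬ Good s.1 s.2}
  have hnext : ∀ (i : ℕ) (s : State), ∃ t : State, Extends s.1.2 t.1.2 ∧
      s.1.2.length < t.1.2.length ∧ (∀ τ, s.1.1 τ → t.1.1 τ) ∧
      ∃ e, (¬ IllFounded (treeAt e) ∧ Φ i t.1.2 e) ∨
        (IllFounded (treeAt e) ∧ ∀ τ, Φ i τ e → t.1.1 τ) := by
    rintro i ⟨⟨θ, σ⟩, hθ, hσ⟩
    obtain ⟨θ', σ', h₁, h₂, h⟩ := exists_extends_decides hθ hσ (hΦ i) (hmono i)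
    exact ⟨⟨(θ', σ'), h₁, h₂⟩, h⟩
  choose next hext hlen hθ hdec using hnext
  let s : ℕ → State := fun t => Nat.rec
    ⟨(fun _ => False, []), primrecPred_false, not_good_false _⟩ next t
  have hpre : ∀ t, ∀ u ≥ t, (s t).1.2 <+: (s u).1.2 := fun t u hu => by
    induction u, hu using Nat.le_induction with
    | base => exact List.prefix_rfl
    | succ u _ ih => exact ih.trans (hext u (s u)).isPrefix
  have hle : ∀ t, ∀ u ≥ t, ∀ τ, (s t).1.1 τ → (s u).1.1 τ := fun t u hu τ h => by
    induction u, hu using Nat.le_induction with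
    | base => exact h
    | succ u _ ih => exact hθ u (s u) τ ih
  have hlength : ∀ t, t ≤ (s t).1.2.length := fun t => by
    induction t with
    | zero => exact Nat.zero_le _
    | succ t ih => exact Nat.succ_le_of_lt (ih.trans_lt (hlen t (s t)))
  have hnil : ∀ t, Extends [] (s t).1.2 := fun t => by
    induction t with
    | zero => exact .refl
    | succ t ih => exact ih.trans (hext t (s t))
  let O : ℕ → ℕ := fun k => (s (k + 1)).1.2.getD k 0
  have hO : ∀ k, (s (k + 1)).1.2[k]? = some (O k) := fun k => by
    have := hlength (k + 1)
    simp only [O, List.getD_eq_getElem?_getD]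
    rw [List.getElem?_eq_getElem (by omega), Option.getD_some]
  have hOs : ∀ t, (List.range (s t).1.2.length).map O = (s t).1.2 := fun t => by
    refine List.ext_getElem (by simp) fun k _ hk => ?_
    rw [List.getElem_map, List.getElem_range, ← Option.some_inj, ← hO,
      ← List.getElem?_eq_getElem hk]
    rcases le_total t (k + 1) with h | h
    · rw [List.getElem?_eq_getElem hk]
      exact (List.prefix_iff_getElem?.1 (hpre _ _ h)) k hk
    · have hk' : k < (s (k + 1)).1.2.length := hlength (k + 1)
      rw [List.getElem?_eq_getElem hk']
      exact ((List.prefix_iff_getElem?.1 (hpre _ _ h)) k hk').symm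
  refine ⟨O, fun k => (hnil (k + 1)).adequate (hO k), fun i hi => ?_⟩
  obtain ⟨e, ⟨he, hφ⟩ | ⟨he, hφ⟩⟩ := hdec i (s i)
  · refine he ((hi e).1 ⟨(s (i + 1)).1.2.length, ?_⟩)
    exact (congrArg (fun l => Φ i l e) (hOs (i + 1))).mpr hφ
  · obtain ⟨k, hk⟩ := (hi e).2 he
    let t := max k (i + 1)
    have ht : Φ i (s t).1.2 e := by
      rw [← hOs t]
      exact hmono i (map_range_isPrefix O ((le_max_left _ _).trans (hlength t))) hk
    exact (s t).2.2 (.base (hle (i + 1) t (le_max_right _ _) _ (hφ _ ht)))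

theorem countable_setOf_primrecRel : {φ : List ℕ → ℕ → Prop | PrimrecRel φ}.Countable := by
  classical
  have hcode : ∀ φ : {φ : List ℕ → ℕ → Prop | PrimrecRel φ}, ∃ c : Code, ∀ σ e,
      c.eval (Encodable.encode (σ, e)) = Part.some (if φ.1 σ e then 1 else 0) := by
    rintro ⟨φ, hφ⟩
    have hφ : PrimrecRel φ := hφ
    have h : Primrec fun a : List ℕ × ℕ => if φ a.1 a.2 then 1 else 0 :=
      Primrec.ite (hφ.comp Primrec.fst Primrec.snd) (Primrec.const 1) (Primrec.const 0)
    obtain ⟨c, hc⟩ := Code.exists_code.1 (Partrec.nat_iff.1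
      (h.comp (Primrec.ofNat (List ℕ × ℕ))).to_comp.partrec)
    refine ⟨c, fun σ e => ?_⟩
    rw [hc]
    simp
  choose c hc using hcode
  refine Set.countable_coe_iff.1 (Function.Injective.countable (f := c) fun φ ψ h => ?_)
  refine Subtype.ext (funext fun σ => funext fun e => ?_)
  have h₁ := hc φ σ e
  rw [h, hc ψ σ e, Part.some_inj] at h₁
  by_cases hφ : φ.1 σ e <;> by_cases hψ : ψ.1 σ e <;> simp_all

theorem exists_adequate_oracle : ∃ O : ℕ → ℕ, (∀ k, Adequate k (O k)) ∧
    ∀ φ, PrimrecRel φ → Persistent φ →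
      ¬ ∀ e, (∃ k, φ ((List.range k).map O) e) ↔ IllFounded (treeAt e) := by
  have hcount : {φ : List ℕ → ℕ → Prop | PrimrecRel φ ∧ Persistent φ}.Countable :=
    countable_setOf_primrecRel.mono fun _ => And.left
  obtain ⟨Φ, hΦ⟩ := hcount.exists_eq_range
    ⟨fun _ _ => False, primrecPred_false, fun _ _ _ _ => id⟩
  have h : ∀ i, PrimrecRel (Φ i) ∧ Persistent (Φ i) := fun i => hΦ.ge ⟨i, rfl⟩
  obtain ⟨O, hO, hdiag⟩ := exists_adequate_of_seq Φ (fun i => (h i).1) fun i => (h i).2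
  refine ⟨O, hO, fun φ h₁ h₂ => ?_⟩
  obtain ⟨i, rfl⟩ := hΦ.le ⟨h₁, h₂⟩
  exact hdiag i

/-! ### Functions recursive in an oracle -/

theorem RecursiveIn.of_eq {O : ℕ → ℕ} {f g : ℕ →. ℕ} (hf : RecursiveIn O f)
    (h : ∀ n, f n = g n) : RecursiveIn O g :=
  (funext h : f = g) ▸ hf

theorem RecursiveIn.of_partrec {O : ℕ → ℕ} {f : ℕ →. ℕ} (hf : Nat.Partrec f) :
    RecursiveIn O f := by
  induction hf with
  | zero => exact .zero
  | succ => exact .succ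
  | left => exact .left
  | right => exact .right
  | pair _ _ ihf ihg => exact .pair ihf ihg
  | comp _ _ ihf ihg => exact .comp ihf ihg
  | prec _ _ ihf ihg => exact .prec ihf ihg
  | rfind _ ihf => exact .rfind ihf

theorem RecursiveIn.of_primrec {O f : ℕ → ℕ} (hf : Primrec f) : RecursiveIn O ↑f :=
  .of_partrec (Partrec.nat_iff.1 hf.to_comp.partrec)

theorem RecursiveIn.comp_total {O f g : ℕ → ℕ} (hf : RecursiveIn O ↑f) (hg : RecursiveIn O ↑g) :
    RecursiveIn O ↑(fun n => f (g n)) :=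
  (hf.comp hg).of_eq fun _ => Part.bind_some _ _

theorem RecursiveIn.pair_total {O f g : ℕ → ℕ} (hf : RecursiveIn O ↑f) (hg : RecursiveIn O ↑g) :
    RecursiveIn O ↑(fun n => Nat.pair (f n) (g n)) :=
  (hf.pair hg).of_eq fun n => by simp [Seq.seq]

/-- The graph of a function, as a set of codes of pairs. -/
def graphSet (O : ℕ → ℕ) : Set ℕ := {z | O z.unpair.1 = z.unpair.2}

theorem recursiveIn_chi_graphSet (O : ℕ → ℕ) : RecursiveIn (chi (graphSet O)) ↑O := by
  have h : RecursiveIn (chi (graphSet O)) ↑(fun n => 1 - chi (graphSet O) n) :=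
    (RecursiveIn.of_primrec (Primrec.nat_sub.comp (Primrec.const 1) Primrec.id)).comp_total
      .oracle
  refine h.rfind.of_eq fun n => Part.eq_some_iff.2 (Nat.mem_rfind.2 ⟨?_, fun {m} hm => ?_⟩)
  · simp [chi, graphSet]
  · simp [chi, graphSet, hm.ne']

/-- The sequence of the first `n` choices made by `O`, starting from the root of the tree `e`. -/
def choices (O : ℕ → ℕ) (e : ℕ) : ℕ → List ℕ
  | 0 => []
  | n + 1 => choices O e n ++ [(O (Encodable.encode (e, choices O e n))).unpair.2]

theorem recursiveIn_choices {Y O : ℕ → ℕ} (hO : RecursiveIn Y ↑O) :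
    RecursiveIn Y ↑(fun z : ℕ => Encodable.encode (choices O z.unpair.1 z.unpair.2)) := by
  have hleft : RecursiveIn Y ↑(fun n : ℕ => n.unpair.1) := .left
  have hright : RecursiveIn Y ↑(fun n : ℕ => n.unpair.2) := .right
  have happend : RecursiveIn Y ↑(fun n : ℕ => Encodable.encode
      (Denumerable.ofNat (List ℕ) n.unpair.1 ++ [n.unpair.2.unpair.2])) :=
    .of_primrec (Primrec.encode.comp (Primrec.list_concat.comp
      ((Primrec.ofNat (List ℕ)).comp (Primrec.fst.comp Primrec.unpair))
      (Primrec.snd.comp (Primrec.unpair.comp (Primrec.snd.comp Primrec.unpair)))))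
  have hlist := hright.comp_total hright
  have hstep := happend.comp_total (hlist.pair_total (hO.comp_total (hleft.pair_total hlist)))
  refine ((RecursiveIn.of_primrec (Primrec.const (Encodable.encode ([] : List ℕ)))).prec
    hstep).of_eq fun z => ?_
  simp only [Nat.unpaired, PFun.coe_val]
  generalize z.unpair.1 = e
  induction z.unpair.2 with
  | zero => rfl
  | succ n ih =>
    simp only [ih]
    simp [choices, Encodable.encode_prod_val]

theorem loqHighForPaths_of_adequate {X : Set ℕ} {O : ℕ → ℕ} (hX : RecursiveIn (chi X) ↑O)
    (hO : ∀ k, Adequate k (O k)) : LoqHighForPaths X := by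
  refine ⟨fun a => (O (Encodable.encode (a.1, choices O a.1 a.2))).unpair.2, ?_, ?_⟩
  · have hleft : RecursiveIn (chi X) ↑(fun n : ℕ => n.unpair.1) := .left
    have hright : RecursiveIn (chi X) ↑(fun n : ℕ => n.unpair.2) := .right
    refine (hright.comp_total (hX.comp_total
      (hleft.pair_total (recursiveIn_choices hX)))).of_eq fun n => ?_
    simp [Encodable.encode_prod_val]
  · intro e he n
    have hmap : ∀ n, (List.range n).map (fun n =>
        (O (Encodable.encode (e, choices O e n))).unpair.2) = choices O e n := fun n => by
      induction n with
      | zero => rfl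
      | succ n ih => rw [List.range_succ, List.map_append, ih]; rfl
    have halive : ∀ n, ¬ Dead (e, choices O e n) := fun n => by
      induction n with
      | zero => exact not_dead_root he
      | succ n ih =>
        have h := hO (Encodable.encode (e, choices O e n))
        rw [Adequate, node, Denumerable.ofNat_encode] at h
        exact h (exists_child_not_dead ih)
    have := mem_treeAt_of_inTree he (inTree_of_not_dead (halive n))
    rwa [← hmap] at this

/-! ### Approximations by finite parts of the oracle -/

/-- The values of `f` are those computed by `p` from initial segments of `O`. -/
structure IsApprox (O : ℕ → ℕ) (f : ℕ →. ℕ) (p : List ℕ → ℕ → Option ℕ) : Prop where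
  primrec : Primrec₂ p
  mono : ∀ ⦃σ τ n v⦄, σ <+: τ → p σ n = some v → p τ n = some v
  mem_iff : ∀ n v, v ∈ f n ↔ ∃ k, p ((List.range k).map O) n = some v

theorem IsApprox.mono_range {O : ℕ → ℕ} {f : ℕ →. ℕ} {p : List ℕ → ℕ → Option ℕ}
    (h : IsApprox O f p) {k l n v : ℕ} (hkl : k ≤ l)
    (hk : p ((List.range k).map O) n = some v) : p ((List.range l).map O) n = some v :=
  h.mono (map_range_isPrefix O hkl) hk

theorem isApprox_of_primrec (O : ℕ → ℕ) {f : ℕ → ℕ} (hf : Primrec f) :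
    IsApprox O ↑f fun _ n => some (f n) where
  primrec := Primrec.option_some.comp (hf.comp Primrec.snd)
  mono _ _ _ _ _ h := h
  mem_iff n v := by simp [eq_comm]

theorem isApprox_chi_graphSet (O : ℕ → ℕ) : IsApprox O ↑(chi (graphSet O)) fun σ n =>
    σ[n.unpair.1]?.map fun v => if v = n.unpair.2 then 1 else 0 where
  primrec := by
    refine Primrec.option_map (Primrec.list_getElem?.comp Primrec.fst
      (Primrec.fst.comp (Primrec.unpair.comp Primrec.snd))) ?_
    exact Primrec.ite (Primrec.eq.comp Primrec.snd (Primrec.snd.comp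
      (Primrec.unpair.comp (Primrec.snd.comp Primrec.fst)))) (Primrec.const 1) (Primrec.const 0)
  mono σ τ n v h hv := by
    obtain ⟨w, hw, rfl⟩ := Option.map_eq_some_iff.1 hv
    obtain ⟨hlt, rfl⟩ := List.getElem?_eq_some_iff.1 hw
    rw [List.prefix_iff_getElem?.1 h _ hlt]
    rfl
  mem_iff n v := by
    have : chi (graphSet O) n = if O n.unpair.1 = n.unpair.2 then 1 else 0 := by
      simp only [chi, graphSet, Set.mem_ofPred_eq]
      congr
    rw [PFun.coe_val, this, Part.mem_some_iff]
    constructor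
    · rintro rfl
      exact ⟨n.unpair.1 + 1, by simp⟩
    · rintro ⟨k, hk⟩
      obtain ⟨w, hw, rfl⟩ := Option.map_eq_some_iff.1 hk
      obtain ⟨hlt, rfl⟩ := List.getElem?_eq_some_iff.1 hw
      simp

theorem IsApprox.pair {O : ℕ → ℕ} {f g : ℕ →. ℕ} {p q : List ℕ → ℕ → Option ℕ}
    (hf : IsApprox O f p) (hg : IsApprox O g q) :
    IsApprox O (fun n => Nat.pair <$> f n <*> g n)
      fun σ n => (p σ n).bind fun a => (q σ n).map (Nat.pair a) where
  primrec := Primrec.option_bind hf.primrec (Primrec.option_map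
    (hg.primrec.comp (Primrec.fst.comp Primrec.fst) (Primrec.snd.comp Primrec.fst))
    (Primrec₂.natPair.comp (Primrec.snd.comp Primrec.fst) Primrec.snd))
  mono σ τ n v h := by
    simp only [Option.bind_eq_some_iff, Option.map_eq_some_iff]
    rintro ⟨a, ha, b, hb, rfl⟩
    exact ⟨a, hf.mono h ha, b, hg.mono h hb, rfl⟩
  mem_iff n v := by
    simp only [Option.bind_eq_some_iff, Option.map_eq_some_iff, Seq.seq, Part.map_eq_map,
      Part.bind_map, Part.mem_bind_iff, Part.mem_map_iff]
    constructor
    · rintro ⟨a, ha, b, hb, rfl⟩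
      obtain ⟨k, hk⟩ := (hf.mem_iff n a).1 ha
      obtain ⟨l, hl⟩ := (hg.mem_iff n b).1 hb
      exact ⟨max k l, a, hf.mono_range (le_max_left _ _) hk, b,
        hg.mono_range (le_max_right _ _) hl, rfl⟩
    · rintro ⟨k, a, ha, b, hb, rfl⟩
      exact ⟨a, (hf.mem_iff n a).2 ⟨k, ha⟩, b, (hg.mem_iff n b).2 ⟨k, hb⟩, rfl⟩

theorem IsApprox.comp {O : ℕ → ℕ} {f g : ℕ →. ℕ} {p q : List ℕ → ℕ → Option ℕ}
    (hf : IsApprox O f p) (hg : IsApprox O g q) :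
    IsApprox O (fun n => g n >>= f) fun σ n => (q σ n).bind (p σ) where
  primrec := Primrec.option_bind hg.primrec
    (hf.primrec.comp (Primrec.fst.comp Primrec.fst) Primrec.snd)
  mono σ τ n v h := by
    simp only [Option.bind_eq_some_iff]
    rintro ⟨a, ha, hb⟩
    exact ⟨a, hg.mono h ha, hf.mono h hb⟩
  mem_iff n v := by
    refine Part.mem_bind_iff.trans ?_
    simp only [Option.bind_eq_some_iff]
    constructor
    · rintro ⟨a, ha, hb⟩
      obtain ⟨k, hk⟩ := (hg.mem_iff n a).1 ha
      obtain ⟨l, hl⟩ := (hf.mem_iff a v).1 hb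
      exact ⟨max k l, a, hg.mono_range (le_max_left _ _) hk, hf.mono_range (le_max_right _ _) hl⟩
    · rintro ⟨k, a, ha, hb⟩
      exact ⟨a, (hg.mem_iff n a).2 ⟨k, ha⟩, (hf.mem_iff a v).2 ⟨k, hb⟩⟩

theorem IsApprox.prec {O : ℕ → ℕ} {f g : ℕ →. ℕ} {p q : List ℕ → ℕ → Option ℕ}
    (hf : IsApprox O f p) (hg : IsApprox O g q) :
    ∃ r, IsApprox O (Nat.unpaired fun a n =>
      n.rec (f a) fun y IH => do let i ← IH; g (Nat.pair a (Nat.pair y i))) r := by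
  let r : List ℕ → ℕ → ℕ → Option ℕ := fun σ a n => Nat.rec (p σ a)
    (fun y IH => IH.bind fun i => q σ (Nat.pair a (Nat.pair y i))) n
  have hsucc : ∀ σ a n v, r σ a (n + 1) = some v ↔
      ∃ i, r σ a n = some i ∧ q σ (Nat.pair a (Nat.pair n i)) = some v :=
    fun _ _ _ _ => Option.bind_eq_some_iff
  have hmono : ∀ ⦃σ τ⦄, σ <+: τ → ∀ a n v, r σ a n = some v → r τ a n = some v := by
    intro σ τ h a n
    induction n with
    | zero => exact fun v => hf.mono h
    | succ n ih =>
      intro v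
      simp only [hsucc]
      rintro ⟨i, hi, hv⟩
      exact ⟨i, ih i hi, hg.mono h hv⟩
  refine ⟨fun σ z => r σ z.unpair.1 z.unpair.2, ?_, fun σ τ z v h => hmono h _ _ v, fun z v => ?_⟩
  · have hfst : Primrec fun a : List ℕ × ℕ => a.2.unpair.1 :=
      Primrec.fst.comp (Primrec.unpair.comp Primrec.snd)
    refine Primrec.nat_rec' (h := fun (a : List ℕ × ℕ) (b : ℕ × Option ℕ) =>
      b.2.bind fun i => q a.1 (Nat.pair a.2.unpair.1 (Nat.pair b.1 i)))
      (Primrec.snd.comp (Primrec.unpair.comp Primrec.snd)) (hf.primrec.comp Primrec.fst hfst) ?_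
    refine Primrec.option_bind (Primrec.snd.comp Primrec.snd) ?_
    exact hg.primrec.comp (Primrec.fst.comp (Primrec.fst.comp Primrec.fst))
      (Primrec₂.natPair.comp (hfst.comp (Primrec.fst.comp Primrec.fst))
        (Primrec₂.natPair.comp (Primrec.fst.comp (Primrec.snd.comp Primrec.fst)) Primrec.snd))
  · simp only [Nat.unpaired]
    generalize z.unpair.1 = a
    induction z.unpair.2 generalizing v with
    | zero => exact hf.mem_iff a v
    | succ n ih =>
      refine Part.mem_bind_iff.trans ?_
      simp only [hsucc]
      constructor
      · rintro ⟨i, hi, hv⟩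
        obtain ⟨k, hk⟩ := (ih i).1 hi
        obtain ⟨l, hl⟩ := (hg.mem_iff _ v).1 hv
        exact ⟨max k l, i, hmono (map_range_isPrefix O (le_max_left _ _)) _ _ _ hk,
          hg.mono_range (le_max_right _ _) hl⟩
      · rintro ⟨k, i, hi, hv⟩
        exact ⟨i, (ih i).2 ⟨k, hi⟩, (hg.mem_iff _ v).2 ⟨k, hv⟩⟩

/-- The first zero of `q`, found by a search below `n`. -/
def search (q : ℕ → Option ℕ) (n : ℕ) : Option ℕ :=
  let m := (List.range n).findIdx fun i => (q i).getD 0 == 0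
  if q m = some 0 then some m else none

theorem search_eq_some_iff {q : ℕ → Option ℕ} {n v : ℕ} :
    search q n = some v ↔ v ≤ n ∧ q v = some 0 ∧ ∀ i < v, ∃ w, q i = some (w + 1) := by
  set m := (List.range n).findIdx fun i => (q i).getD 0 == 0 with hm
  have hmn : m ≤ n := by
    simpa using List.findIdx_le_length (xs := List.range n) (p := fun i => (q i).getD 0 == 0)
  have hlt : ∀ i < m, ∃ w, q i = some (w + 1) := fun i hi => by
    have h := List.not_of_lt_findIdx hi
    rw [List.getElem_range] at h
    rcases hq : q i with _ | _ | w
    · simp [hq] at h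
    · simp [hq] at h
    · exact ⟨w, rfl⟩
  have hsearch : search q n = if q m = some 0 then some m else none := rfl
  rw [hsearch]
  constructor
  · intro h
    split_ifs at h with h₀
    obtain rfl := Option.some_inj.1 h
    exact ⟨hmn, h₀, hlt⟩
  · rintro ⟨hv, h₀, h₁⟩
    obtain h | rfl | h := lt_trichotomy m v
    · obtain ⟨w, hw⟩ := h₁ m h
      have := List.findIdx_getElem (xs := List.range n) (p := fun i => (q i).getD 0 == 0)
        (w := by simpa using h.trans_le hv)
      rw [List.getElem_range, ← hm] at this
      simp [hw] at this
    · exact if_pos h₀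
    · obtain ⟨w, hw⟩ := hlt v h
      simp [h₀] at hw

theorem IsApprox.rfind {O : ℕ → ℕ} {f : ℕ →. ℕ} {p : List ℕ → ℕ → Option ℕ}
    (hf : IsApprox O f p) :
    IsApprox O (fun a => Nat.rfind fun n => (fun m => m = 0) <$> f (Nat.pair a n))
      fun σ a => search (fun n => p σ (Nat.pair a n)) σ.length where
  primrec := by
    have hm : Primrec fun a : List ℕ × ℕ => (List.range a.1.length).findIdx fun n =>
        (p a.1 (Nat.pair a.2 n)).getD 0 == 0 := by
      refine Primrec.list_findIdx (Primrec.list_range.comp (Primrec.list_length.comp Primrec.fst))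
        (Primrec.beq.comp (Primrec.option_getD.comp (hf.primrec.comp ?_ ?_) (Primrec.const 0))
          (Primrec.const 0))
      · exact Primrec.fst.comp Primrec.fst
      · exact Primrec₂.natPair.comp (Primrec.snd.comp Primrec.fst) Primrec.snd
    exact Primrec.ite (Primrec.eq.comp (hf.primrec.comp Primrec.fst
      (Primrec₂.natPair.comp Primrec.snd hm)) (Primrec.const (some 0)))
      (Primrec.option_some.comp hm) (Primrec.const none)
  mono σ τ a v h := by
    simp only [search_eq_some_iff]
    rintro ⟨h₁, h₂, h₃⟩
    refine ⟨h₁.trans h.length_le, hf.mono h h₂, fun i hi => ?_⟩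
    obtain ⟨w, hw⟩ := h₃ i hi
    exact ⟨w, hf.mono h hw⟩
  mem_iff a v := by
    refine Nat.mem_rfind.trans ?_
    simp only [search_eq_some_iff, Part.map_eq_map, Part.mem_map_iff]
    constructor
    · rintro ⟨⟨u, hu, hu₀⟩, h⟩
      obtain rfl : u = 0 := by simpa using hu₀
      obtain ⟨k, hk⟩ := (hf.mem_iff _ _).1 hu
      have hi : ∀ i, ∃ l, i < v → ∃ w,
          p ((List.range l).map O) (Nat.pair a i) = some (w + 1) := fun i => by
        by_cases hi : i < v
        · obtain ⟨w, hw, hw₀⟩ := h hi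
          obtain ⟨l, hl⟩ := (hf.mem_iff _ _).1 hw
          cases w with
          | zero => simp at hw₀
          | succ w => exact ⟨l, fun _ => ⟨w, hl⟩⟩
        · exact ⟨0, fun h => absurd h hi⟩
      choose l hl using hi
      refine ⟨v + k + (Finset.range v).sup l, by simp; omega,
        hf.mono_range (by omega) hk, fun i hi => ?_⟩
      obtain ⟨w, hw⟩ := hl i hi
      have : l i ≤ (Finset.range v).sup l := Finset.le_sup (Finset.mem_range.2 hi)
      exact ⟨w, hf.mono_range (by omega) hw⟩
    · rintro ⟨k, -, h₀, h⟩
      refine ⟨⟨0, (hf.mem_iff _ _).2 ⟨k, h₀⟩, by simp⟩, fun {i} hi => ?_⟩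
      obtain ⟨w, hw⟩ := h i hi
      exact ⟨w + 1, (hf.mem_iff _ _).2 ⟨k, hw⟩, by simp⟩

theorem RecursiveIn.exists_isApprox {O : ℕ → ℕ} {f : ℕ →. ℕ}
    (hf : RecursiveIn (chi (graphSet O)) f) : ∃ p, IsApprox O f p := by
  induction hf with
  | zero => exact ⟨_, isApprox_of_primrec O (Primrec.const 0)⟩
  | succ => exact ⟨_, isApprox_of_primrec O Primrec.succ⟩
  | left => exact ⟨_, isApprox_of_primrec O (Primrec.fst.comp Primrec.unpair)⟩
  | right => exact ⟨_, isApprox_of_primrec O (Primrec.snd.comp Primrec.unpair)⟩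
  | oracle => exact ⟨_, isApprox_chi_graphSet O⟩
  | pair _ _ ihf ihg => exact ⟨_, ihf.choose_spec.pair ihg.choose_spec⟩
  | comp _ _ ihf ihg => exact ⟨_, ihf.choose_spec.comp ihg.choose_spec⟩
  | prec _ _ ihf ihg => exact ihf.choose_spec.prec ihg.choose_spec
  | rfind _ ihf => exact ⟨_, ihf.choose_spec.rfind⟩

theorem RetHighForPaths.exists_persistent {O : ℕ → ℕ} (h : RetHighForPaths (graphSet O)) :
    ∃ φ, PrimrecRel φ ∧ Persistent φ ∧
      ∀ e, (∃ k, φ ((List.range k).map O) e) ↔ IllFounded (treeAt e) := by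
  obtain ⟨F, hF, hill, hwf⟩ := h
  obtain ⟨p, hp⟩ := RecursiveIn.exists_isApprox hF
  refine ⟨fun σ e => (p σ (Nat.pair e 0)).isSome = true, ?_, fun σ τ e hστ h => ?_, fun e => ?_⟩
  · exact Primrec.eq.comp (Primrec.option_isSome.comp (hp.primrec.comp Primrec.fst
      (Primrec₂.natPair.comp Primrec.snd (Primrec.const 0)))) (Primrec.const true)
  · obtain ⟨v, hv⟩ := Option.isSome_iff_exists.1 h
    exact Option.isSome_iff_exists.2 ⟨v, hp.mono hστ hv⟩
  · have hdom : (∃ k, (p ((List.range k).map O) (Nat.pair e 0)).isSome = true) ↔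
        (F (e, 0)).Dom := by
      simp only [Option.isSome_iff_exists]
      rw [exists_comm]
      simp only [← hp.mem_iff, ← Part.dom_iff_mem]
      simp
    rw [hdom]
    refine ⟨fun h => by_contra fun he => hwf e he 0 h, fun he => ?_⟩
    obtain ⟨g, -, hg⟩ := hill e he
    rw [hg]
    trivial

/-- There is a set that is loquaciously high for paths but not
reticently high for paths. -/
theorem exists_loqHighForPaths_not_retHighForPaths :
    ∃ X : Set ℕ, LoqHighForPaths X ∧ ¬ RetHighForPaths X := by
  obtain ⟨O, hO, hdiag⟩ := exists_adequate_oracle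
  refine ⟨graphSet O, loqHighForPaths_of_adequate (recursiveIn_chi_graphSet O) hO, fun h => ?_⟩
  obtain ⟨φ, hφ, hmono, hiff⟩ := h.exists_persistent
  exact hdiag φ hφ hmono hiff

end CFT
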